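/- The function S defined on (1/√2, 1) by S(k) = 4√(2k²−1)·K(k) is continuous and strictly increasing on (1/√2, 1), and its image S((1/√2, 1)) equals the whole interval (0, +∞). -/

import Mathlib

open Real Filter Set

/-- Complete elliptic integral of the first kind. -/
noncomputable def Kell (k : ℝ) : ℝ :=
  ∫ t in (0:ℝ)..1, 1 / Real.sqrt ((1 - t^2) * (1 - k^2 * t^2))

/-- S(k) = 4√(2k²−1)·K(k). -/
noncomputable def Sfun (k : ℝ) : ℝ := 4 * Real.sqrt (2 * k^2 - 1) * Kell k

/-- H(k), the numerator in the definition of φ. -/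
noncomputable def Hfun (k : ℝ) : ℝ :=
  ∫ t in Real.sqrt ((2 * k^2 - 1) / k^2)..1,
    1 / Real.sqrt ((1 - t^2) * (1 - k^2 * (1 - t^2)))

/-- φ(k) = H(k)/K(k). -/
noncomputable def phiFun (k : ℝ) : ℝ := Hfun k / Kell k

/-- ξ_n = 2|αn − ⌊αn + 1/2⌋|. -/
noncomputable def xiSeq (α : ℝ) (n : ℕ) : ℝ :=
  2 * |α * n - (⌊α * n + 1/2⌋ : ℝ)|

theorem one_sub_sq_mul_sq_pos {k t : ℝ} (hk0 : 0 ≤ k) (hk1 : k < 1) (ht : t ∈ Set.Icc (0:ℝ) 1) :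
    0 < 1 - k ^ 2 * t ^ 2 := by
  have h : k * t < 1 := by nlinarith [ht.1, ht.2]
  have h' : 0 ≤ k * t := mul_nonneg hk0 ht.1
  nlinarith

theorem Kell_integrand_mono {k l t : ℝ} (hk : 0 ≤ k) (hkl : k ≤ l) (hl : l < 1)
    (ht : t ∈ Set.Icc (0:ℝ) 1) :
    1 / Real.sqrt ((1 - t ^ 2) * (1 - k ^ 2 * t ^ 2)) ≤
      1 / Real.sqrt ((1 - t ^ 2) * (1 - l ^ 2 * t ^ 2)) := by
  rcases eq_or_lt_of_le ht.2 with rfl | ht1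
  · simp
  have ht2 : 0 < 1 - t ^ 2 := by nlinarith [ht.1]
  have hlt := one_sub_sq_mul_sq_pos (hk.trans hkl) hl ht
  have hkl2 : k ^ 2 ≤ l ^ 2 := by gcongr
  apply one_div_le_one_div_of_le (Real.sqrt_pos.2 (mul_pos ht2 hlt))
  gcongr

theorem intervalIntegrable_one_div_sqrt_one_sub_sq :
    IntervalIntegrable (fun t : ℝ => 1 / Real.sqrt (1 - t ^ 2)) MeasureTheory.volume 0 1 := by
  apply intervalIntegral.intervalIntegrable_deriv_of_nonneg
    (g := Real.arcsin) Real.continuous_arcsin.continuousOn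
  · intro x hx
    simp only [zero_le_one, min_eq_left, max_eq_right] at hx
    exact Real.hasDerivAt_arcsin (by linarith [hx.1]) hx.2.ne
  · intro x _
    positivity

theorem Kell_integrand_le {k t : ℝ} (hk : 0 ≤ k) (hk1 : k < 1) (ht : t ∈ Set.Icc (0:ℝ) 1) :
    1 / Real.sqrt ((1 - t ^ 2) * (1 - k ^ 2 * t ^ 2)) ≤
      1 / Real.sqrt (1 - k ^ 2) * (1 / Real.sqrt (1 - t ^ 2)) := by
  rcases eq_or_lt_of_le ht.2 with rfl | ht1
  · simp
  have ht2 : 0 < 1 - t ^ 2 := by nlinarith [ht.1]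
  have hk2 : 0 < 1 - k ^ 2 := by nlinarith
  rw [one_div_mul_one_div, ← Real.sqrt_mul hk2.le, mul_comm (1 - k ^ 2)]
  apply one_div_le_one_div_of_le (Real.sqrt_pos.2 (mul_pos ht2 hk2))
  gcongr
  nlinarith [sq_nonneg k]

theorem measurable_Kell_integrand (k : ℝ) :
    Measurable fun t : ℝ => 1 / Real.sqrt ((1 - t ^ 2) * (1 - k ^ 2 * t ^ 2)) := by
  fun_prop

theorem intervalIntegrable_Kell_integrand {k : ℝ} (hk : 0 ≤ k) (hk1 : k < 1) :
    IntervalIntegrable (fun t : ℝ => 1 / Real.sqrt ((1 - t ^ 2) * (1 - k ^ 2 * t ^ 2)))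
      MeasureTheory.volume 0 1 := by
  apply (intervalIntegrable_one_div_sqrt_one_sub_sq.const_mul (1 / Real.sqrt (1 - k ^ 2))).mono_fun'
    (measurable_Kell_integrand k).aestronglyMeasurable
  refine (MeasureTheory.ae_restrict_iff' measurableSet_uIoc).2 (.of_forall fun t ht => ?_)
  rw [Set.uIoc_of_le zero_le_one] at ht
  beta_reduce
  rw [Real.norm_of_nonneg (by positivity)]
  exact Kell_integrand_le hk hk1 ⟨ht.1.le, ht.2⟩

theorem continuousOn_Kell : ContinuousOn Kell (Set.Ioo 0 1) := by
  intro k hk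
  apply ContinuousAt.continuousWithinAt
  obtain ⟨l, hkl, hl⟩ := exists_between hk.2
  apply intervalIntegral.continuousAt_of_dominated_interval
    (bound := fun t => 1 / Real.sqrt ((1 - t ^ 2) * (1 - l ^ 2 * t ^ 2)))
  · exact .of_forall fun x => (measurable_Kell_integrand x).aestronglyMeasurable
  · filter_upwards [Ioo_mem_nhds hk.1 hkl] with x hx
    refine .of_forall fun t ht => ?_
    rw [Set.uIoc_of_le zero_le_one] at ht
    rw [Real.norm_of_nonneg (by positivity)]
    exact Kell_integrand_mono hx.1.le hx.2.le hl ⟨ht.1.le, ht.2⟩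
  · exact intervalIntegrable_Kell_integrand (hk.1.trans hkl).le hl
  · refine .of_forall fun t ht => ?_
    rw [Set.uIoc_of_le zero_le_one] at ht
    rcases eq_or_lt_of_le ht.2 with rfl | ht1
    · simp [continuousAt_const]
    have ht2 : 0 < 1 - t ^ 2 := by nlinarith [ht.1]
    have hkt := one_sub_sq_mul_sq_pos hk.1.le hk.2 ⟨ht.1.le, ht.2⟩
    refine ContinuousAt.div continuousAt_const (by fun_prop) ?_
    exact (Real.sqrt_pos.2 (mul_pos ht2 hkt)).ne'

theorem Kell_le_Kell {k l : ℝ} (hk : 0 ≤ k) (hkl : k ≤ l) (hl : l < 1) : Kell k ≤ Kell l :=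
  intervalIntegral.integral_mono_on zero_le_one
    (intervalIntegrable_Kell_integrand hk (hkl.trans_lt hl))
    (intervalIntegrable_Kell_integrand (hk.trans hkl) hl)
    fun _ ht => Kell_integrand_mono hk hkl hl ht

theorem Kell_pos {k : ℝ} (hk : 0 ≤ k) (hk1 : k < 1) : 0 < Kell k := by
  apply intervalIntegral.intervalIntegral_pos_of_pos_on
    (intervalIntegrable_Kell_integrand hk hk1) _ zero_lt_one
  intro t ht
  have ht2 : 0 < 1 - t ^ 2 := by nlinarith [ht.1, ht.2]
  have hkt := one_sub_sq_mul_sq_pos hk hk1 ⟨ht.1.le, ht.2.le⟩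
  positivity

/-- Logarithmic lower bound, witnessing the divergence of `Kell` at `1`. -/
theorem neg_log_one_sub_div_two_le_Kell {k : ℝ} (hk : 0 < k) (hk1 : k < 1) :
    -Real.log (1 - k) / 2 ≤ Kell k := by
  have hpos : ∀ t ∈ Set.Icc (0:ℝ) 1, 0 < 1 - k * t := fun t ht => by nlinarith [ht.1, ht.2]
  have hint : IntervalIntegrable (fun t : ℝ => 1 / (2 * (1 - k * t)))
      MeasureTheory.volume 0 1 := by
    apply ContinuousOn.intervalIntegrable
    rw [Set.uIcc_of_le zero_le_one]
    refine ContinuousOn.div (by fun_prop) (by fun_prop) fun t ht => ?_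
    have := hpos t ht
    positivity
  have heq : ∫ t in (0:ℝ)..1, 1 / (2 * (1 - k * t)) = -Real.log (1 - k) / (2 * k) := by
    rw [intervalIntegral.integral_eq_sub_of_hasDerivAt
      (f := fun t => -Real.log (1 - k * t) / (2 * k)) _ hint]
    · simp
    · intro t ht
      rw [Set.uIcc_of_le zero_le_one] at ht
      have h := hpos t ht
      have hd : HasDerivAt (fun t : ℝ => 1 - k * t) (-k) t := by
        simpa using ((hasDerivAt_id t).const_mul k).const_sub 1
      refine ((hd.log h.ne').neg.div_const (2 * k)).congr_deriv ?_
      field_simp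
  have hlog : 0 ≤ -Real.log (1 - k) := by
    linarith [Real.log_nonpos (by linarith : 0 ≤ 1 - k) (by linarith)]
  calc -Real.log (1 - k) / 2 ≤ -Real.log (1 - k) / (2 * k) := by
        apply div_le_div_of_nonneg_left hlog (by positivity) (by linarith)
    _ = ∫ t in (0:ℝ)..1, 1 / (2 * (1 - k * t)) := heq.symm
    _ ≤ Kell k := by
        apply intervalIntegral.integral_mono_on_of_le_Ioo zero_le_one hint
          (intervalIntegrable_Kell_integrand hk.le hk1)
        intro t ht
        have ht' : t ∈ Set.Icc (0:ℝ) 1 := ⟨ht.1.le, ht.2.le⟩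
        have ht2 : 0 < 1 - t ^ 2 := by nlinarith [ht.1, ht.2]
        have hkt := one_sub_sq_mul_sq_pos hk.le hk1 ht'
        have h := hpos t ht'
        have hle : 1 - t ^ 2 ≤ 1 - k ^ 2 * t ^ 2 := by
          nlinarith [mul_nonneg (by nlinarith : 0 ≤ 1 - k ^ 2) (sq_nonneg t)]
        have hfac : 1 - k ^ 2 * t ^ 2 ≤ 2 * (1 - k * t) := by nlinarith [sq_nonneg (1 - k * t)]
        apply one_div_le_one_div_of_le (Real.sqrt_pos.2 (mul_pos ht2 hkt))
        refine le_trans ?_ hfac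
        rw [Real.sqrt_le_left hkt.le, sq (1 - k ^ 2 * t ^ 2)]
        gcongr

theorem continuousOn_Sfun : ContinuousOn Sfun (Set.Ioo 0 1) :=
  ContinuousOn.mul (by fun_prop) continuousOn_Kell

theorem Sfun_one_div_sqrt_two : Sfun (1 / Real.sqrt 2) = 0 := by
  simp [Sfun]

theorem strictMonoOn_Sfun : StrictMonoOn Sfun (Set.Ico (1 / Real.sqrt 2) 1) := by
  intro k hk l hl hkl
  have h0 : 0 < 1 / Real.sqrt 2 := by positivity
  have hk0 : 0 < k := h0.trans_le hk.1
  have hk2 : 0 ≤ 2 * k ^ 2 - 1 := by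
    have h := pow_le_pow_left₀ h0.le hk.1 2
    rw [div_pow, Real.sq_sqrt zero_le_two] at h
    linarith
  have hsqrt : Real.sqrt (2 * k ^ 2 - 1) < Real.sqrt (2 * l ^ 2 - 1) := by
    apply Real.sqrt_lt_sqrt hk2
    gcongr
  exact mul_lt_mul (by linarith) (Kell_le_Kell hk0.le hkl.le hl.2) (Kell_pos hk0.le hk.2)
    (by positivity)

theorem exists_lt_Sfun (y : ℝ) (hy : 0 < y) : ∃ k ∈ Set.Ioo (1 / Real.sqrt 2) 1, y < Sfun k := by
  have hexp : Real.exp (-(y + 2)) < 1 / 5 := by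
    have h1 : (3:ℝ) * 2 < Real.exp (y + 2) := by
      have h2 : Real.exp (1 + 1) < Real.exp (y + 2) := Real.exp_lt_exp.2 (by linarith)
      rw [Real.exp_add] at h2
      nlinarith [Real.exp_one_gt_d9]
    rw [Real.exp_neg, ← one_div]
    exact one_div_lt_one_div_of_lt (by norm_num) (by linarith)
  have hexp0 := Real.exp_pos (-(y + 2))
  set k := 1 - Real.exp (-(y + 2)) with hk
  have hk45 : 4 / 5 < k := by linarith
  have hk1 : k < 1 := by linarith
  refine ⟨k, ⟨?_, hk1⟩, ?_⟩
  · rw [one_div, ← Real.sqrt_inv, Real.sqrt_lt' (by linarith)]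
    nlinarith
  · have hK := neg_log_one_sub_div_two_le_Kell (by linarith) hk1
    have hlog : Real.log (1 - k) = -(y + 2) := by rw [hk, sub_sub_cancel, Real.log_exp]
    rw [hlog] at hK
    have hs : 1 / 2 ≤ Real.sqrt (2 * k ^ 2 - 1) := Real.le_sqrt_of_sq_le (by nlinarith)
    unfold Sfun
    nlinarith

/-- S is continuous and strictly increasing on (1/√2, 1), with image (0, +∞). -/
theorem stmt_3 :
    ContinuousOn Sfun (Set.Ioo (1 / Real.sqrt 2) 1) ∧
    StrictMonoOn Sfun (Set.Ioo (1 / Real.sqrt 2) 1) ∧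
    Sfun '' Set.Ioo (1 / Real.sqrt 2) 1 = Set.Ioi 0 := by
  have h0 : 0 < 1 / Real.sqrt 2 := by positivity
  have h1 : 1 / Real.sqrt 2 < 1 := by
    rw [div_lt_one (by positivity)]
    exact Real.one_lt_sqrt_two
  refine ⟨continuousOn_Sfun.mono (Set.Ioo_subset_Ioo_left h0.le),
    strictMonoOn_Sfun.mono Set.Ioo_subset_Ico_self, Set.Subset.antisymm ?_ ?_⟩
  · rintro _ ⟨k, hk, rfl⟩
    rw [Set.mem_Ioi, ← Sfun_one_div_sqrt_two]
    exact strictMonoOn_Sfun ⟨le_rfl, h1⟩ ⟨hk.1.le, hk.2⟩ hk.1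
  · intro y hy
    obtain ⟨l, hl, hyl⟩ := exists_lt_Sfun y hy
    have hcont : ContinuousOn Sfun (Set.Icc (1 / Real.sqrt 2) l) :=
      continuousOn_Sfun.mono fun x hx => ⟨h0.trans_le hx.1, hx.2.trans_lt hl.2⟩
    obtain ⟨k, hk, rfl⟩ := intermediate_value_Ioo hl.1.le hcont
      ⟨by rwa [Sfun_one_div_sqrt_two], hyl⟩
    exact ⟨k, ⟨hk.1, hk.2.trans hl.2⟩, rfl⟩
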